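/- For every ε ≥ 0: if σ ∈ Δ(S) is an ε-approximate Bayes Nash equilibrium in the strategic form, then η(σ) is an ε-approximate Bayes Nash equilibrium in the agent normal form. Conversely, for every ε-approximate Bayes Nash equilibrium π in the agent normal form, there exists an ε-approximate Bayes Nash equilibrium σ in the strategic form with η(σ) = π. -/

import Mathlib

open Finset
open scoped Classical

noncomputable section

/-- `f` is a probability distribution on the finite set `X`. -/
def IsDist {X : Type*} [Fintype X] (f : X → ℝ) : Prop :=
  (∀ x, f x ∈ Set.Icc (0 : ℝ) 1) ∧ ∑ x, f x = 1

variable {ι : Type*} [Fintype ι] [Nonempty ι]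
  {Θ A : ι → Type*}
  [∀ i, Fintype (Θ i)] [∀ i, Nonempty (Θ i)]
  [∀ i, Fintype (A i)] [∀ i, Nonempty (A i)]

/-- The map `η : Δ(S) → Δ(A)^Θ` : `η(σ)(θ;a) = ∑_{s : s(θ) = a} σ(s)`. -/
def eta (σ : ((i : ι) → Θ i → A i) → ℝ) :
    ((i : ι) → Θ i) → ((i : ι) → A i) → ℝ :=
  fun θ a => ∑ s : (i : ι) → Θ i → A i, if (fun i => s i (θ i)) = a then σ s else 0

/-- `σ ∈ Σ_Prod` : `σ` is a product of distributions over individual strategy sets. -/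
def IsProdStratDist (σ : ((i : ι) → Θ i → A i) → ℝ) : Prop :=
  ∃ σi : (i : ι) → (Θ i → A i) → ℝ,
    (∀ i, IsDist (σi i)) ∧ ∀ s, σ s = ∏ i, σi i (s i)

/-- `π ∈ Π_Prod` : `π` is a type-wise product distribution. -/
def TypewiseProduct (π : ((i : ι) → Θ i) → ((i : ι) → A i) → ℝ) : Prop :=
  ∃ p : (i : ι) → Θ i → A i → ℝ,
    (∀ i θi, IsDist (p i θi)) ∧ ∀ θ a, π θ a = ∏ i, p i (θ i) (a i)

/-- Incentive constraints of ε-approximate Bayes Nash equilibria in the strategic form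
(identical to the strategic-form correlated equilibrium constraints). -/
def SFIncentive (ρ : ((i : ι) → Θ i) → ℝ)
    (v : (i : ι) → ((j : ι) → Θ j) → ((j : ι) → A j) → ℝ) (ε : ℝ)
    (σ : ((i : ι) → Θ i → A i) → ℝ) : Prop :=
  ∀ (i : ι) (φ : (Θ i → A i) → Θ i → A i),
    ∑ θ, ρ θ * ∑ s : (j : ι) → Θ j → A j, σ s * v i θ (fun j => s j (θ j)) ≥
      ∑ θ, ρ θ * ∑ s : (j : ι) → Θ j → A j,
        σ s * v i θ (Function.update (fun j => s j (θ j)) i (φ (s i) (θ i))) - ε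

/-- Incentive constraints of ε-approximate Bayes Nash equilibria in the agent normal form. -/
def ANFIncentive (ρ : ((i : ι) → Θ i) → ℝ)
    (v : (i : ι) → ((j : ι) → Θ j) → ((j : ι) → A j) → ℝ) (ε : ℝ)
    (π : ((i : ι) → Θ i) → ((i : ι) → A i) → ℝ) : Prop :=
  ∀ (i : ι) (φ : Θ i → A i → A i),
    ∑ θ, ρ θ * ∑ a : (j : ι) → A j, π θ a * v i θ a ≥
      ∑ θ, ρ θ * ∑ a : (j : ι) → A j,
        π θ a * v i θ (Function.update a i (φ (θ i) (a i))) - ε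

lemma IsDist.prod {κ : Type*} [Fintype κ] {X : κ → Type*} [∀ k, Fintype (X k)]
    {f : (k : κ) → X k → ℝ} (hf : ∀ k, IsDist (f k)) :
    IsDist fun x : (k : κ) → X k => ∏ k, f k (x k) := by
  refine ⟨fun x => ⟨Finset.prod_nonneg fun k _ => ((hf k).1 _).1,
    Finset.prod_le_one (fun k _ => ((hf k).1 _).1) fun k _ => ((hf k).1 _).2⟩, ?_⟩
  rw [← Fintype.piFinset_univ, ← Finset.prod_univ_sum]
  exact Finset.prod_eq_one fun k _ => (hf k).2

lemma IsDist.map {X Y : Type*} [Fintype X] [Fintype Y] {f : X → ℝ} (hf : IsDist f) (g : X → Y) :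
    IsDist fun y => ∑ x, if g x = y then f x else 0 := by
  refine ⟨fun y => ⟨Finset.sum_nonneg fun x _ => ?_, ?_⟩, ?_⟩
  · split_ifs
    exacts [(hf.1 x).1, le_rfl]
  · rw [← hf.2]
    refine Finset.sum_le_sum fun x _ => ?_
    split_ifs
    exacts [le_rfl, (hf.1 x).1]
  · rw [Finset.sum_comm]
    simpa using hf.2

/-- Coordinate marginals of a finite product distribution. -/
lemma sum_ite_prod_eq {κ B : Type*} [Fintype κ] [Fintype B] {p : κ → B → ℝ}
    (hp : ∀ k, ∑ b, p k b = 1) (k₀ : κ) (b₀ : B) :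
    (∑ t : κ → B, if t k₀ = b₀ then ∏ k, p k (t k) else 0) = p k₀ b₀ := by
  have h : ∀ t : κ → B, (if t k₀ = b₀ then ∏ k, p k (t k) else 0) =
      ∏ k, if k = k₀ → t k = b₀ then p k (t k) else 0 := fun t => by
    rw [Finset.prod_ite_zero]
    simp
  rw [Finset.sum_congr rfl fun t _ => h t, ← Fintype.piFinset_univ,
    ← Finset.prod_univ_sum (fun _ => Finset.univ)
      fun k b => if k = k₀ → b = b₀ then p k b else 0,
    Finset.prod_eq_single k₀]
  · simp
  · intro k _ hk
    simpa [hk] using hp k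
  · simp

/-- Under a product distribution, the `i`-th coordinate may be resampled independently. -/
lemma sum_prod_mul_resample {κ : Type*} [Fintype κ] {X : κ → Type*} [∀ k, Fintype (X k)]
    {f : (k : κ) → X k → ℝ} (i : κ) (hf : ∑ t, f i t = 1)
    (G : X i → ((k : κ) → X k) → ℝ) (hG : ∀ t s t', G t (Function.update s i t') = G t s) :
    ∑ s, (∏ k, f k (s k)) * G (s i) s = ∑ t, f i t * ∑ s, (∏ k, f k (s k)) * G t s := by
  let e : X i × ((k : κ) → X k) → X i × ((k : κ) → X k) :=
    fun q => (q.2 i, Function.update q.2 i q.1)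
  have he : Function.Involutive e := fun q => by simp [e]
  have hw (t : X i) (s : (k : κ) → X k) :
      f i (s i) * ∏ k, f k (Function.update s i t k) = f i t * ∏ k, f k (s k) := by
    rw [← Finset.mul_prod_erase univ _ (mem_univ i),
      ← Finset.mul_prod_erase univ (fun k => f k (s k)) (mem_univ i),
      Finset.prod_congr rfl fun k hk => by rw [Function.update_of_ne (Finset.ne_of_mem_erase hk)],
      Function.update_self]
    ring
  calc ∑ s, (∏ k, f k (s k)) * G (s i) s
      = ∑ t, ∑ s, f i t * (∏ k, f k (s k)) * G (s i) s := by
        simp_rw [mul_assoc, ← Finset.mul_sum, ← Finset.sum_mul, hf, one_mul]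
    _ = ∑ q : X i × ((k : κ) → X k), f i q.1 * (∏ k, f k (q.2 k)) * G (q.2 i) q.2 := by
        rw [Fintype.sum_prod_type]
    _ = ∑ q : X i × ((k : κ) → X k), f i q.1 * (∏ k, f k (q.2 k)) * G q.1 q.2 :=
        Fintype.sum_equiv he.toPerm _ _ fun q => by
          change _ = f i (q.2 i) * (∏ k, f k (Function.update q.2 i q.1 k)) *
            G (q.2 i) (Function.update q.2 i q.1)
          rw [hw, hG]
    _ = ∑ t, f i t * ∑ s, (∏ k, f k (s k)) * G t s := by
        simp_rw [Fintype.sum_prod_type, Finset.mul_sum, mul_assoc]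

omit [Nonempty ι] [∀ i, Nonempty (Θ i)] [∀ i, Nonempty (A i)] in
lemma sum_eta_mul (σ : ((i : ι) → Θ i → A i) → ℝ) (θ : (i : ι) → Θ i)
    (g : ((i : ι) → A i) → ℝ) :
    ∑ a, eta σ θ a * g a = ∑ s, σ s * g fun j => s j (θ j) := by
  simp_rw [eta, Finset.sum_mul]
  rw [Finset.sum_comm]
  simp [ite_mul]

omit [Nonempty ι] [∀ i, Nonempty (Θ i)] [∀ i, Nonempty (A i)] in
lemma eta_prod {σ : ((i : ι) → Θ i → A i) → ℝ} {f : (i : ι) → (Θ i → A i) → ℝ}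
    (hσ : ∀ s, σ s = ∏ i, f i (s i)) (θ : (i : ι) → Θ i) (a : (i : ι) → A i) :
    eta σ θ a = ∏ i, ∑ t, if t (θ i) = a i then f i t else 0 := by
  rw [Finset.prod_univ_sum, Fintype.piFinset_univ]
  refine Finset.sum_congr rfl fun s _ => ?_
  rw [Finset.prod_ite_zero, hσ]
  simp [funext_iff]

omit [Nonempty ι] [∀ i, Nonempty (Θ i)] [∀ i, Nonempty (A i)] in
lemma ANFIncentive.eta_of_sf {ρ : ((i : ι) → Θ i) → ℝ}
    {v : (i : ι) → ((j : ι) → Θ j) → ((j : ι) → A j) → ℝ} {ε : ℝ}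
    {σ : ((i : ι) → Θ i → A i) → ℝ} (h : SFIncentive ρ v ε σ) :
    ANFIncentive ρ v ε (eta σ) := by
  intro i φ
  have := h i fun t θi => φ θi (t θi)
  simpa only [sum_eta_mul] using this

omit [Nonempty ι] [∀ i, Nonempty (Θ i)] [∀ i, Nonempty (A i)] in
lemma SFIncentive.of_anf_eta {ρ : ((i : ι) → Θ i) → ℝ}
    {v : (i : ι) → ((j : ι) → Θ j) → ((j : ι) → A j) → ℝ} {ε : ℝ}
    {σ : ((i : ι) → Θ i → A i) → ℝ} (hσ : IsProdStratDist σ)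
    (h : ANFIncentive ρ v ε (eta σ)) : SFIncentive ρ v ε σ := by
  obtain ⟨f, hf, hσf⟩ := hσ
  obtain rfl : σ = fun s => ∏ i, f i (s i) := funext hσf
  intro i φ
  have hdev (t : Θ i → A i) := h i fun θi _ => φ t θi
  simp only [sum_eta_mul] at hdev
  have hres (θ : (j : ι) → Θ j) := sum_prod_mul_resample (f := f) i (hf i).2
    (fun (t : Θ i → A i) (s : (j : ι) → Θ j → A j) => v i θ (Function.update (fun j => s j (θ j)) i
      (φ t (θ i)))) fun t s t' => by
      congr 1
      ext j
      by_cases hj : j = i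
      · subst hj; simp
      · simp [hj]
  simp only [hres]
  have hswap (F : (Θ i → A i) → ((j : ι) → Θ j) → ℝ) :
      ∑ θ, ρ θ * ∑ t, f i t * F t θ = ∑ t, f i t * ∑ θ, ρ θ * F t θ := by
    simp_rw [Finset.mul_sum]
    rw [Finset.sum_comm]
    exact Finset.sum_congr rfl fun t _ => Finset.sum_congr rfl fun θ _ => mul_left_comm _ _ _
  rw [hswap, ge_iff_le, sub_le_iff_le_add]
  refine (Finset.sum_le_sum fun t _ =>
    mul_le_mul_of_nonneg_left (sub_le_iff_le_add.1 (hdev t)) ((hf i).1 t).1).trans_eq ?_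
  rw [← Finset.sum_mul, (hf i).2, one_mul]

/-- Bayes Nash equilibria in the strategic form and in the agent normal form correspond
to each other under `η`. -/
theorem bayesNash_strategicForm_agentNormalForm
    (ρ : ((i : ι) → Θ i) → ℝ) (hρ : IsDist ρ)
    (v : (i : ι) → ((j : ι) → Θ j) → ((j : ι) → A j) → ℝ)
    (hv : ∀ i θ a, v i θ a ∈ Set.Icc (0 : ℝ) 1)
    (ε : ℝ) (hε : 0 ≤ ε) :
    (∀ σ : ((i : ι) → Θ i → A i) → ℝ,
      IsDist σ → IsProdStratDist σ → SFIncentive ρ v ε σ →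
        TypewiseProduct (eta σ) ∧ ANFIncentive ρ v ε (eta σ)) ∧
    (∀ π : ((i : ι) → Θ i) → ((i : ι) → A i) → ℝ,
      TypewiseProduct π → ANFIncentive ρ v ε π →
        ∃ σ : ((i : ι) → Θ i → A i) → ℝ,
          IsDist σ ∧ IsProdStratDist σ ∧ SFIncentive ρ v ε σ ∧ eta σ = π) := by
  refine ⟨fun σ _ hprod hσ => ⟨?_, ANFIncentive.eta_of_sf hσ⟩, fun π hprod hπ => ?_⟩
  · obtain ⟨f, hf, hσf⟩ := hprod
    exact ⟨fun i θi b => ∑ t, if t θi = b then f i t else 0,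
      fun i θi => (hf i).map fun t => t θi, eta_prod hσf⟩
  · obtain ⟨p, hp, hπp⟩ := hprod
    let f : (i : ι) → (Θ i → A i) → ℝ := fun i t => ∏ θi, p i θi (t θi)
    have hf : ∀ i, IsDist (f i) := fun i => IsDist.prod (hp i)
    let σ : ((i : ι) → Θ i → A i) → ℝ := fun s => ∏ i, f i (s i)
    have hσ : IsProdStratDist σ := ⟨f, hf, fun _ => rfl⟩
    have heta : eta σ = π := by
      funext θ a
      rw [eta_prod (fun _ => rfl), hπp]
      exact Finset.prod_congr rfl fun i _ => sum_ite_prod_eq (fun θi => (hp i θi).2) _ _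
    exact ⟨σ, IsDist.prod hf, hσ, SFIncentive.of_anf_eta hσ (heta ▸ hπ), heta⟩
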